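/- arXiv:2201.02496 — 2 statements merged into one kernel-verified Lean document; each statement's English description precedes it below -/
import Mathlib

section
/- Let Φ be a finite set of intuitionistic {⊗,⊸,&,⊕,1,⊥}-formulas and Γ ⊢ Π an intuitionistic {⊗,⊸,&,⊕,1,⊥}-sequent. Then Γ ⊢ Π is provable in FLew[Φ] if and only if !Φ,Γ ⊢ Π is provable in ILZW', where !Φ is the multiset containing !B once for each B ∈ Φ. -/
namespace Affine

/-- Intuitionistic formulas: the language 𝓛 (⊗, ⊸, &, ⊕, !, 1, ⊤, ⊥, 0)
together with the extra ILAL modality §. -/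
inductive IForm : Type where
  | var (n : ℕ)
  | one
  | top
  | bot
  | zero
  | tensor (A B : IForm)
  | limp (A B : IForm)
  | and (A B : IForm)
  | or (A B : IForm)
  | bang (A : IForm)
  | para (A : IForm)

namespace IForm

/-- membership in the language 𝓛 (no §) -/
def inL : IForm → Prop
  | para _ => False
  | tensor A B => inL A ∧ inL B
  | limp A B => inL A ∧ inL B
  | and A B => inL A ∧ inL B
  | or A B => inL A ∧ inL B
  | bang A => inL A
  | _ => True

/-- membership in the ⊥-free language 𝓛⁺ -/
def inLp : IForm → Prop
  | para _ => False
  | bot => False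
  | tensor A B => inLp A ∧ inLp B
  | limp A B => inLp A ∧ inLp B
  | and A B => inLp A ∧ inLp B
  | or A B => inLp A ∧ inLp B
  | bang A => inLp A
  | _ => True

/-- {⊗,⊸,&,⊕,1,⊥}-formulas -/
def inFLei : IForm → Prop
  | var _ => True
  | one => True
  | bot => True
  | tensor A B => inFLei A ∧ inFLei B
  | limp A B => inFLei A ∧ inFLei B
  | and A B => inFLei A ∧ inFLei B
  | or A B => inFLei A ∧ inFLei B
  | _ => False

/-- {⊗,⊸,&,⊕,1}-formulas -/
def inFLeiP : IForm → Prop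
  | var _ => True
  | one => True
  | tensor A B => inFLeiP A ∧ inFLeiP B
  | limp A B => inFLeiP A ∧ inFLeiP B
  | and A B => inFLeiP A ∧ inFLeiP B
  | or A B => inFLeiP A ∧ inFLeiP B
  | _ => False

/-- purely implicational ({⊸}-) formulas -/
def inImp : IForm → Prop
  | var _ => True
  | limp A B => inImp A ∧ inImp B
  | _ => False

/-- {⊸,!}-formulas -/
def inImpBang : IForm → Prop
  | var _ => True
  | limp A B => inImpBang A ∧ inImpBang B
  | bang A => inImpBang A
  | _ => False

/-- {⊸,!,§}-formulas: the language of ILAL -/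
def inLAL : IForm → Prop
  | var _ => True
  | limp A B => inLAL A ∧ inLAL B
  | bang A => inLAL A
  | para A => inLAL A
  | _ => False

end IForm

/-- A parametrized intuitionistic sequent calculus: `K` is the set of allowed
formulas (the fragment), `ax` the set of non-logical axioms, and the remaining
fields tell which optional rules are available. -/
structure ICalc where
  K : IForm → Prop
  ax : Set IForm
  wL : Prop      -- unrestricted left weakening (W)
  wR : Prop      -- right weakening (W')
  bD : Prop      -- dereliction (!D)
  bP : Prop      -- promotion (!P)
  bF : Prop      -- functorial promotion (!F)
  bW : Prop      -- !-weakening (!W), for linear systems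
  lB : Prop      -- the ILAL rule (!)
  lP : Prop      -- the ILAL rule (§)

/-- Provability of an intuitionistic sequent `Γ ⊢ X` (X a stoup) in the
parametrized calculus `C`. -/
inductive IPrv (C : ICalc) : Multiset IForm → Option IForm → Prop where
  | axiom' {B} : B ∈ C.ax → IPrv C 0 (some B)
  | init {A} : C.K A → IPrv C {A} (some A)
  | oneR : C.K .one → IPrv C 0 (some .one)
  | botL : C.K .bot → IPrv C {.bot} none
  | topR {Γ} : C.K .top → (∀ A ∈ Γ, C.K A) → IPrv C Γ (some .top)
  | zeroL {Γ X} : C.K .zero → (∀ A ∈ Γ, C.K A) → (∀ A, X = some A → C.K A) →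
      IPrv C (.zero ::ₘ Γ) X
  | cut {Γ Δ X A} : IPrv C Γ (some A) → IPrv C (A ::ₘ Δ) X → IPrv C (Γ + Δ) X
  | oneL {Γ X} : C.K .one → IPrv C Γ X → IPrv C (.one ::ₘ Γ) X
  | botR {Γ} : C.K .bot → IPrv C Γ none → IPrv C Γ (some .bot)
  | limpL {Γ Δ X A B} : C.K (.limp A B) → IPrv C Γ (some A) → IPrv C (B ::ₘ Δ) X →
      IPrv C (.limp A B ::ₘ (Γ + Δ)) X
  | limpR {Γ A B} : C.K (.limp A B) → IPrv C (A ::ₘ Γ) (some B) →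
      IPrv C Γ (some (.limp A B))
  | tensorL {Γ X A B} : C.K (.tensor A B) → IPrv C (A ::ₘ B ::ₘ Γ) X →
      IPrv C (.tensor A B ::ₘ Γ) X
  | tensorR {Γ Δ A B} : C.K (.tensor A B) → IPrv C Γ (some A) → IPrv C Δ (some B) →
      IPrv C (Γ + Δ) (some (.tensor A B))
  | withL1 {Γ X A B} : C.K (.and A B) → IPrv C (A ::ₘ Γ) X → IPrv C (.and A B ::ₘ Γ) X
  | withL2 {Γ X A B} : C.K (.and A B) → IPrv C (B ::ₘ Γ) X → IPrv C (.and A B ::ₘ Γ) X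
  | withR {Γ A B} : C.K (.and A B) → IPrv C Γ (some A) → IPrv C Γ (some B) →
      IPrv C Γ (some (.and A B))
  | plusL {Γ X A B} : C.K (.or A B) → IPrv C (A ::ₘ Γ) X → IPrv C (B ::ₘ Γ) X →
      IPrv C (.or A B ::ₘ Γ) X
  | plusR1 {Γ A B} : C.K (.or A B) → IPrv C Γ (some A) → IPrv C Γ (some (.or A B))
  | plusR2 {Γ A B} : C.K (.or A B) → IPrv C Γ (some B) → IPrv C Γ (some (.or A B))
  | bangD {Γ X A} : C.bD → C.K (.bang A) → IPrv C (A ::ₘ Γ) X → IPrv C (.bang A ::ₘ Γ) X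
  | bangP {Γ : Multiset IForm} {A} : C.bP → C.K (.bang A) → (∀ B ∈ Γ, C.K (.bang B)) →
      IPrv C (Γ.map .bang) (some A) → IPrv C (Γ.map .bang) (some (.bang A))
  | bangF {Γ : Multiset IForm} {A} : C.bF → C.K (.bang A) → (∀ B ∈ Γ, C.K (.bang B)) →
      IPrv C Γ (some A) → IPrv C (Γ.map .bang) (some (.bang A))
  | weakL {Γ X A} : C.wL → C.K A → IPrv C Γ X → IPrv C (A ::ₘ Γ) X
  | bangW {Γ X A} : C.bW → C.K (.bang A) → IPrv C Γ X → IPrv C (.bang A ::ₘ Γ) X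
  | bangC {Γ X A} : C.K (.bang A) → IPrv C (.bang A ::ₘ .bang A ::ₘ Γ) X →
      IPrv C (.bang A ::ₘ Γ) X
  | weakR {Γ A} : C.wR → C.K A → IPrv C Γ none → IPrv C Γ (some A)
  | lalBang {A} {E : Multiset IForm} : C.lB → C.K (.bang A) →
      (∀ B ∈ E, C.K (.bang B)) → Multiset.card E ≤ 1 → IPrv C E (some A) →
      IPrv C (E.map .bang) (some (.bang A))
  | lalPara {Γ Δ : Multiset IForm} {A} : C.lP → C.K (.para A) → (∀ B ∈ Γ, C.K (.bang B)) →
      (∀ B ∈ Δ, C.K (.para B)) → IPrv C (Γ + Δ) (some A) →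
      IPrv C (Γ.map .bang + Δ.map .para) (some (.para A))

/-- ILZW with a set of non-logical axioms. -/
def ILZWc (Φ : Set IForm) : ICalc :=
  ⟨IForm.inL, Φ, True, False, True, True, False, False, False, False⟩

/-- ILZW' = ILZW + right weakening, with a set of non-logical axioms. -/
def ILZWpc (Φ : Set IForm) : ICalc :=
  ⟨IForm.inL, Φ, True, True, True, True, False, False, False, False⟩

/-- ILLW: the ⊥-free fragment of ILZW. -/
def ILLWc (Φ : Set IForm) : ICalc :=
  ⟨IForm.inLp, Φ, True, False, True, True, False, False, False, False⟩

/-- IEZW: intuitionistic elementary affine logic with bottom. -/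
def IEZWc (Φ : Set IForm) : ICalc :=
  ⟨IForm.inL, Φ, True, False, False, False, True, False, False, False⟩

/-- IELW: the ⊥-free fragment of IEZW. -/
def IELWc (Φ : Set IForm) : ICalc :=
  ⟨IForm.inLp, Φ, True, False, False, False, True, False, False, False⟩

/-- FLei: the {⊗,⊸,&,⊕,1,⊥}-fragment of ILZW. -/
def FLeic (Φ : Set IForm) : ICalc :=
  ⟨IForm.inFLei, Φ, True, False, True, True, False, False, False, False⟩

/-- FLew: the {⊗,⊸,&,⊕,1,⊥}-fragment of ILZW'. -/
def FLewc (Φ : Set IForm) : ICalc :=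
  ⟨IForm.inFLei, Φ, True, True, True, True, False, False, False, False⟩

/-- FLei⁺: the {⊗,⊸,&,⊕,1}-fragment of ILZW. -/
def FLeiPc (Φ : Set IForm) : ICalc :=
  ⟨IForm.inFLeiP, Φ, True, False, True, True, False, False, False, False⟩

/-- BCK: the {⊸}-fragment of ILZW. -/
def BCKc (Φ : Set IForm) : ICalc :=
  ⟨IForm.inImp, Φ, True, False, True, True, False, False, False, False⟩

/-- The {⊸,!}-fragment of ILLW. -/
def ImpBangILLWc (Φ : Set IForm) : ICalc :=
  ⟨IForm.inImpBang, Φ, True, False, True, True, False, False, False, False⟩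

/-- ILL: intuitionistic linear logic (no unrestricted weakening, only !W). -/
def ILLc (Φ : Set IForm) : ICalc :=
  ⟨IForm.inLp, Φ, False, False, True, True, False, True, False, False⟩

/-- BCI: the {⊸}-fragment of ILL. -/
def BCIc (Φ : Set IForm) : ICalc :=
  ⟨IForm.inImp, Φ, False, False, True, True, False, True, False, False⟩

/-- ILAL: intuitionistic light affine logic. -/
def ILALc (Φ : Set IForm) : ICalc :=
  ⟨IForm.inLAL, Φ, True, False, False, False, False, False, True, True⟩

/-- Classical formulas: literals p, p⊥ and the connectives ⊗, ⅋, &, ⊕, 1, ⊥, ⊤, 0, !, ?. -/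
inductive CForm : Type where
  | pos (n : ℕ)
  | neg (n : ℕ)
  | one
  | bot
  | top
  | zero
  | tensor (A B : CForm)
  | par (A B : CForm)
  | and (A B : CForm)
  | or (A B : CForm)
  | bang (A : CForm)
  | quest (A : CForm)

namespace CForm

/-- De Morgan (involutive) negation. -/
def dual : CForm → CForm
  | pos n => neg n
  | neg n => pos n
  | one => bot
  | bot => one
  | top => zero
  | zero => top
  | tensor A B => par A.dual B.dual
  | par A B => tensor A.dual B.dual
  | and A B => or A.dual B.dual
  | or A B => and A.dual B.dual
  | bang A => quest A.dual
  | quest A => bang A.dual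

/-- the propositional variable `x` occurs in the formula -/
def hasVar (x : ℕ) : CForm → Prop
  | pos n => n = x
  | neg n => n = x
  | one => False
  | bot => False
  | top => False
  | zero => False
  | tensor A B => hasVar x A ∨ hasVar x B
  | par A B => hasVar x A ∨ hasVar x B
  | and A B => hasVar x A ∨ hasVar x B
  | or A B => hasVar x A ∨ hasVar x B
  | bang A => hasVar x A
  | quest A => hasVar x A

/-- {⊗,⅋,&,⊕,1,⊥}-formulas (the language of InFLew) -/
def inMALL : CForm → Prop
  | pos _ => True
  | neg _ => True
  | one => True
  | bot => True
  | tensor A B => inMALL A ∧ inMALL B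
  | par A B => inMALL A ∧ inMALL B
  | and A B => inMALL A ∧ inMALL B
  | or A B => inMALL A ∧ inMALL B
  | _ => False

end CForm

/-- A parametrized one-sided classical sequent calculus. -/
structure CCalc where
  K : CForm → Prop
  ax : Set CForm
  wk : Prop      -- unrestricted weakening (W)
  der : Prop     -- dereliction (?)
  prom : Prop    -- promotion (!)
  funcF : Prop   -- the functorial rule (F) of ELLW
  qW : Prop      -- ?-weakening (?W), for LL

/-- Provability of a one-sided sequent `⊢ Γ` in the parametrized calculus `C`. -/
inductive CPrv (C : CCalc) : Multiset CForm → Prop where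
  | axiom' {B} : B ∈ C.ax → CPrv C {B}
  | init {A} : C.K A → C.K A.dual → CPrv C {A, A.dual}
  | one : C.K .one → CPrv C {.one}
  | top {Γ} : C.K .top → (∀ A ∈ Γ, C.K A) → CPrv C (.top ::ₘ Γ)
  | cut {Γ Δ A} : CPrv C (A ::ₘ Γ) → CPrv C (A.dual ::ₘ Δ) → CPrv C (Γ + Δ)
  | bot {Γ} : C.K .bot → CPrv C Γ → CPrv C (.bot ::ₘ Γ)
  | tensor {Γ Δ A B} : C.K (.tensor A B) → CPrv C (A ::ₘ Γ) → CPrv C (B ::ₘ Δ) →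
      CPrv C (.tensor A B ::ₘ (Γ + Δ))
  | par {Γ A B} : C.K (.par A B) → CPrv C (A ::ₘ B ::ₘ Γ) → CPrv C (.par A B ::ₘ Γ)
  | with' {Γ A B} : C.K (.and A B) → CPrv C (A ::ₘ Γ) → CPrv C (B ::ₘ Γ) →
      CPrv C (.and A B ::ₘ Γ)
  | plus1 {Γ A B} : C.K (.or A B) → CPrv C (A ::ₘ Γ) → CPrv C (.or A B ::ₘ Γ)
  | plus2 {Γ A B} : C.K (.or A B) → CPrv C (B ::ₘ Γ) → CPrv C (.or A B ::ₘ Γ)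
  | der {Γ A} : C.der → C.K (.quest A) → CPrv C (A ::ₘ Γ) → CPrv C (.quest A ::ₘ Γ)
  | prom {Γ : Multiset CForm} {A} : C.prom → C.K (.bang A) → (∀ B ∈ Γ, C.K (.quest B)) →
      CPrv C (A ::ₘ Γ.map .quest) → CPrv C (.bang A ::ₘ Γ.map .quest)
  | wk {Γ A} : C.wk → C.K A → CPrv C Γ → CPrv C (A ::ₘ Γ)
  | questW {Γ A} : C.qW → C.K (.quest A) → CPrv C Γ → CPrv C (.quest A ::ₘ Γ)
  | questC {Γ A} : C.K (.quest A) → CPrv C (.quest A ::ₘ .quest A ::ₘ Γ) →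
      CPrv C (.quest A ::ₘ Γ)
  | funcF {Γ : Multiset CForm} {A} : C.funcF → C.K (.bang A) → (∀ B ∈ Γ, C.K (.quest B)) →
      CPrv C (A ::ₘ Γ) → CPrv C (.bang A ::ₘ Γ.map .quest)

/-- LLW: classical affine logic, with a set of non-logical axioms. -/
def LLWc (Φ : Set CForm) : CCalc :=
  ⟨fun _ => True, Φ, True, True, True, False, False⟩

/-- ELLW: classical elementary affine logic. -/
def ELLWc (Φ : Set CForm) : CCalc :=
  ⟨fun _ => True, Φ, True, False, False, True, False⟩

/-- InFLew: the {⊗,⅋,&,⊕,1,⊥}-fragment of LLW. -/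
def InFLewc (Φ : Set CForm) : CCalc :=
  ⟨CForm.inMALL, Φ, True, False, False, False, False⟩

/-- LL: classical linear logic (weakening restricted to ?W). -/
def LLc (Φ : Set CForm) : CCalc :=
  ⟨fun _ => True, Φ, False, True, True, False, True⟩

/-- The translation (·)^[F] of classical formulas into intuitionistic formulas,
where ¬_F B := B ⊸ F. -/
def trF (F : IForm) : CForm → IForm
  | .pos n => .limp (.var n) F
  | .neg n => .var n
  | .one => .limp .one F
  | .bot => .one
  | .top => .zero
  | .zero => .limp .zero F
  | .tensor B C => .limp (.limp (trF F B) F) (trF F C)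
  | .par B C => .limp (.limp (trF F B) (.limp (trF F C) F)) F
  | .and B C => .or (trF F B) (trF F C)
  | .or B C => .limp (.or (.limp (trF F B) F) (.limp (trF F C) F)) F
  | .bang B => .limp (.bang (.limp (trF F B) F)) F
  | .quest B => .bang (trF F B)

/-- The embedding (·)̲ of ⊥-free intuitionistic formulas into classical formulas. -/
def emb : IForm → CForm
  | .var n => .pos n
  | .one => .one
  | .top => .top
  | .bot => .bot
  | .zero => .zero
  | .tensor A B => .tensor (emb A) (emb B)
  | .limp A B => .par (emb A).dual (emb B)
  | .and A B => .and (emb A) (emb B)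
  | .or A B => .or (emb A) (emb B)
  | .bang A => .bang (emb A)
  | .para A => .bang (emb A)

end Affine

namespace Affine

lemma IForm.inL_of_inFLei {A : IForm} (h : A.inFLei) : A.inL := by
  induction A <;> simp_all [IForm.inFLei, IForm.inL]

namespace IPrv

variable {C : ICalc} {Γ Δ : Multiset IForm} {X : Option IForm}

/-- Left weakening by a multiset of formulas. -/
lemma weakening (hw : C.wL) (hΔ : ∀ A ∈ Δ, C.K A) (h : IPrv C Γ X) : IPrv C (Δ + Γ) X := by
  induction Δ using Multiset.induction_on with
  | empty => simpa using h
  | cons A Δ ih =>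
    rw [Multiset.cons_add]
    exact .weakL hw (hΔ A (by simp)) (ih fun B hB => hΔ B (by simp [hB]))

/-- Contraction of a multiset of banged formulas. -/
lemma contraction (hΔ : ∀ A ∈ Δ, C.K (.bang A))
    (h : IPrv C (Δ.map .bang + (Δ.map .bang + Γ)) X) : IPrv C (Δ.map .bang + Γ) X := by
  induction Δ using Multiset.induction_on generalizing Γ with
  | empty => simpa using h
  | cons A Δ ih =>
    have hc : IPrv C (.bang A ::ₘ .bang A ::ₘ (Δ.map .bang + (Δ.map .bang + Γ))) X := by
      simpa [Multiset.cons_add, Multiset.add_cons] using h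
    have h' := ih (Γ := .bang A ::ₘ Γ) (fun B hB => hΔ B (by simp [hB]))
      (by simpa [Multiset.add_cons] using IPrv.bangC (hΔ A (by simp)) hc)
    simpa [Multiset.cons_add, Multiset.add_cons] using h'

/-- Provable antecedent formulas can be cut away. -/
lemma cut_all (hΔ : ∀ A ∈ Δ, IPrv C 0 (some A)) (h : IPrv C (Δ + Γ) X) : IPrv C Γ X := by
  induction Δ using Multiset.induction_on with
  | empty => simpa using h
  | cons A Δ ih =>
    rw [Multiset.cons_add] at h
    exact ih (fun B hB => hΔ B (by simp [hB])) (by simpa using IPrv.cut (hΔ A (by simp)) h)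

/-- Ex falso, in calculi with left and right weakening. -/
lemma of_bot_mem (hwL : C.wL) (hwR : C.wR) (hΓ : ∀ A ∈ Γ, C.K A) (hX : ∀ A, X = some A → C.K A)
    (h : .bot ∈ Γ) : IPrv C Γ X := by
  obtain ⟨Δ, rfl⟩ := Multiset.exists_cons_of_mem h
  have h0 : IPrv C {.bot} X := by
    have hb : IPrv C {.bot} none := .botL (hΓ _ (by simp))
    cases X with
    | none => exact hb
    | some A => exact .weakR hwR (hX A rfl) hb
  have := h0.weakening hwL (Δ := Δ) fun A hA => hΓ A (by simp [hA])
  rwa [add_comm, Multiset.singleton_add] at this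

/-- Every antecedent proves `1`, in calculi with left weakening. -/
lemma one_of_wL (hwL : C.wL) (h1 : C.K .one) (hΓ : ∀ A ∈ Γ, C.K A) :
    IPrv C Γ (some .one) := by
  simpa using (IPrv.oneR h1).weakening hwL hΓ

/-- Non-logical axioms can be replaced by banged antecedent formulas. -/
lemma bang_of_flewc {Φ : Finset IForm} (hΦ : ∀ B ∈ Φ, B.inFLei) (h : IPrv (FLewc ↑Φ) Γ X) :
    IPrv (ILZWpc ∅) (Φ.val.map IForm.bang + Γ) X := by
  have hK : ∀ {A : IForm}, A.inFLei → (ILZWpc ∅).K A := IForm.inL_of_inFLei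
  have hB : ∀ A ∈ Φ.val, (ILZWpc ∅).K (.bang A) := fun A hA => IForm.inL_of_inFLei (A := A) (hΦ A hA)
  have hM : ∀ A ∈ Φ.val.map IForm.bang, (ILZWpc ∅).K A := by
    intro A hA
    obtain ⟨B, hB', rfl⟩ := Multiset.mem_map.1 hA
    exact hB B hB'
  have hw : (ILZWpc ∅).wL := trivial
  induction h with
  | @axiom' B h =>
    have hmem : B ∈ Φ := h
    obtain ⟨Δ, hΔ⟩ := Multiset.exists_cons_of_mem (show B ∈ Φ.val from hmem)
    have hb : IPrv (ILZWpc ∅) (.bang B ::ₘ 0) (some B) :=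
      .bangD trivial (hB B hmem) (.init (hK (hΦ B hmem)))
    have := hb.weakening hw (Δ := Δ.map .bang) (fun A hA => hM A (by rw [hΔ]; simp_all))
    rw [hΔ, add_zero, Multiset.map_cons]
    rwa [Multiset.add_cons, add_zero] at this
  | init h => exact (IPrv.init (hK h)).weakening hw hM
  | oneR h => exact (IPrv.oneR (hK h)).weakening hw hM
  | botL h => exact (IPrv.botL (hK h)).weakening hw hM
  | topR h => exact h.elim
  | zeroL h => exact h.elim
  | cut _ _ ih₁ ih₂ =>
    rw [Multiset.add_cons] at ih₂
    refine contraction hB ?_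
    have := ih₁.cut ih₂
    rwa [add_add_add_comm, add_assoc] at this
  | oneL h _ ih => rw [Multiset.add_cons]; exact .oneL (hK h) ih
  | botR h _ ih => exact .botR (hK h) ih
  | limpL h _ _ ih₁ ih₂ =>
    rw [Multiset.add_cons] at ih₂
    refine contraction hB ?_
    have := IPrv.limpL (hK h) ih₁ ih₂
    rw [add_add_add_comm, add_assoc] at this
    simpa only [Multiset.add_cons] using this
  | limpR h _ ih => rw [Multiset.add_cons] at ih; exact .limpR (hK h) ih
  | tensorL h _ ih =>
    simp only [Multiset.add_cons] at ih ⊢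
    exact .tensorL (hK h) ih
  | tensorR h _ _ ih₁ ih₂ =>
    refine contraction hB ?_
    have := IPrv.tensorR (hK h) ih₁ ih₂
    rwa [add_add_add_comm, add_assoc] at this
  | withL1 h _ ih => rw [Multiset.add_cons] at ih ⊢; exact .withL1 (hK h) ih
  | withL2 h _ ih => rw [Multiset.add_cons] at ih ⊢; exact .withL2 (hK h) ih
  | withR h _ _ ih₁ ih₂ => exact .withR (hK h) ih₁ ih₂
  | plusL h _ _ ih₁ ih₂ =>
    rw [Multiset.add_cons] at ih₁ ih₂ ⊢
    exact .plusL (hK h) ih₁ ih₂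
  | plusR1 h _ ih => exact .plusR1 (hK h) ih
  | plusR2 h _ ih => exact .plusR2 (hK h) ih
  | bangD _ h => exact h.elim
  | bangP _ h => exact h.elim
  | bangF h => exact h.elim
  | weakL _ h _ ih => rw [Multiset.add_cons]; exact .weakL hw (hK h) ih
  | bangW h => exact h.elim
  | bangC h => exact h.elim
  | weakR _ h _ ih => exact .weakR trivial (hK h) ih
  | lalBang h => exact h.elim
  | lalPara h => exact h.elim

end IPrv

open Classical in
/-- The collapse of formulas into the language of FLew: `⊤` becomes `1`, `0` becomes `⊥`, and
`!A` becomes `1` or `⊥` according to whether the collapse of `A` is a theorem of FLew[`Φ`]. -/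
noncomputable def collapse (Φ : Set IForm) : IForm → IForm
  | .var n => .var n
  | .one => .one
  | .top => .one
  | .bot => .bot
  | .zero => .bot
  | .tensor A B => .tensor (collapse Φ A) (collapse Φ B)
  | .limp A B => .limp (collapse Φ A) (collapse Φ B)
  | .and A B => .and (collapse Φ A) (collapse Φ B)
  | .or A B => .or (collapse Φ A) (collapse Φ B)
  | .bang A => if IPrv (FLewc Φ) 0 (some (collapse Φ A)) then .one else .bot
  | .para _ => .one

variable {Φ : Set IForm}

lemma collapse_inFLei (A : IForm) : (collapse Φ A).inFLei := by
  induction A <;> simp_all [collapse, IForm.inFLei]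
  split <;> trivial

lemma collapse_of_inFLei {A : IForm} (h : A.inFLei) : collapse Φ A = A := by
  induction A <;> simp_all [collapse, IForm.inFLei]

/-- Collapsing turns ILZW' proofs into FLew[`Φ`] proofs. -/
lemma IPrv.collapse {Γ : Multiset IForm} {X : Option IForm} (h : IPrv (ILZWpc ∅) Γ X) :
    IPrv (FLewc Φ) (Γ.map (collapse Φ)) (X.map (collapse Φ)) := by
  have hK : ∀ A, (FLewc Φ).K (Affine.collapse Φ A) := collapse_inFLei
  have hM : ∀ Γ : Multiset IForm, ∀ A ∈ Γ.map (Affine.collapse Φ), (FLewc Φ).K A := by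
    intro Γ A hA
    obtain ⟨B, -, rfl⟩ := Multiset.mem_map.1 hA
    exact hK B
  have hO : ∀ X : Option IForm, ∀ A, X.map (Affine.collapse Φ) = some A → (FLewc Φ).K A := by
    rintro X A hA
    obtain ⟨B, -, rfl⟩ := Option.map_eq_some_iff.1 hA
    exact hK B
  have hw : (FLewc Φ).wL := trivial
  have hw' : (FLewc Φ).wR := trivial
  have h1 : (FLewc Φ).K .one := trivial
  induction h with
  | axiom' h => exact h.elim
  | init _ => simpa using IPrv.init (hK _)
  | oneR _ => exact .oneR h1
  | botL h => exact .botL h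
  | topR _ _ => exact one_of_wL hw h1 (hM _)
  | zeroL _ _ _ => exact of_bot_mem hw hw' (hM _) (hO _) (by simp [Affine.collapse])
  | cut _ _ ih₁ ih₂ =>
    rw [Multiset.map_cons] at ih₂
    rw [Multiset.map_add]
    exact ih₁.cut ih₂
  | oneL _ _ ih => rw [Multiset.map_cons]; exact .oneL h1 ih
  | botR h _ ih => exact .botR h ih
  | @limpL Γ Δ X A B _ _ _ ih₁ ih₂ =>
    rw [Multiset.map_cons] at ih₂
    rw [Multiset.map_cons, Multiset.map_add]
    exact .limpL (hK (.limp A B)) ih₁ ih₂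
  | @limpR Γ A B _ _ ih => rw [Multiset.map_cons] at ih; exact .limpR (hK (.limp A B)) ih
  | @tensorL Γ X A B _ _ ih =>
    simp only [Multiset.map_cons] at ih ⊢
    exact .tensorL (hK (.tensor A B)) ih
  | @tensorR Γ Δ A B _ _ _ ih₁ ih₂ =>
    rw [Multiset.map_add]
    exact .tensorR (hK (.tensor A B)) ih₁ ih₂
  | @withL1 Γ X A B _ _ ih =>
    rw [Multiset.map_cons] at ih ⊢
    exact .withL1 (hK (.and A B)) ih
  | @withL2 Γ X A B _ _ ih =>
    rw [Multiset.map_cons] at ih ⊢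
    exact .withL2 (hK (.and A B)) ih
  | @withR Γ A B _ _ _ ih₁ ih₂ => exact .withR (hK (.and A B)) ih₁ ih₂
  | @plusL Γ X A B _ _ _ ih₁ ih₂ =>
    rw [Multiset.map_cons] at ih₁ ih₂ ⊢
    exact .plusL (hK (.or A B)) ih₁ ih₂
  | @plusR1 Γ A B _ _ ih => exact .plusR1 (hK (.or A B)) ih
  | @plusR2 Γ A B _ _ ih => exact .plusR2 (hK (.or A B)) ih
  | @bangD Γ X A _ _ _ ih =>
    by_cases hA : IPrv (FLewc Φ) 0 (some (Affine.collapse Φ A))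
    · rw [Multiset.map_cons] at ih ⊢
      rw [Affine.collapse, if_pos hA]
      exact .oneL h1 (by simpa using hA.cut ih)
    · exact of_bot_mem hw hw' (hM _) (hO _) (by simp [Affine.collapse, hA])
  | @bangP Γ A _ _ _ _ ih =>
    by_cases hA : IPrv (FLewc Φ) 0 (some (Affine.collapse Φ A))
    · rw [Option.map_some, Affine.collapse, if_pos hA]
      exact one_of_wL hw h1 (hM _)
    by_cases hΓ : ∀ B ∈ Γ, IPrv (FLewc Φ) 0 (some (Affine.collapse Φ B))
    · refine absurd (cut_all (Γ := 0) ?_ (by simpa only [add_zero, Option.map_some] using ih)) hA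
      intro D hD
      simp only [Multiset.mem_map, exists_exists_and_eq_and] at hD
      obtain ⟨B, hB, rfl⟩ := hD
      rw [Affine.collapse, if_pos (hΓ B hB)]
      exact .oneR h1
    · push Not at hΓ
      obtain ⟨B, hB, hB'⟩ := hΓ
      refine of_bot_mem hw hw' (hM _) (hO _) ?_
      simp only [Multiset.mem_map, exists_exists_and_eq_and]
      exact ⟨B, hB, by rw [Affine.collapse, if_neg hB']⟩
  | bangF h => exact h.elim
  | weakL _ _ _ ih => rw [Multiset.map_cons]; exact .weakL hw (hK _) ih
  | bangW h => exact h.elim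
  | @bangC Γ X A _ _ ih =>
    by_cases hA : IPrv (FLewc Φ) 0 (some (Affine.collapse Φ A))
    · rw [Multiset.map_cons] at ih
      have : IPrv (FLewc Φ) 0 (some (Affine.collapse Φ (.bang A))) := by
        rw [Affine.collapse, if_pos hA]
        exact .oneR h1
      simpa using this.cut ih
    · exact of_bot_mem hw hw' (hM _) (hO _) (by simp [Affine.collapse, hA])
  | weakR _ _ _ ih => exact .weakR hw' (hK _) ih
  | lalBang h => exact h.elim
  | lalPara h => exact h.elim

/-- `Γ ⊢ X` is provable in FLew[Φ] iff `!Φ,Γ ⊢ X` is provable in ILZW'. -/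
theorem flew_deducibility_iff_ilzwp (Φ : Finset IForm) (Γ : Multiset IForm)
    (X : Option IForm)
    (hΦ : ∀ B ∈ Φ, B.inFLei) (hΓ : ∀ A ∈ Γ, A.inFLei)
    (hX : ∀ A, X = some A → A.inFLei) :
    IPrv (FLewc ↑Φ) Γ X ↔ IPrv (ILZWpc ∅) (Φ.val.map IForm.bang + Γ) X := by
  refine ⟨IPrv.bang_of_flewc hΦ, fun h => ?_⟩
  have hc := h.collapse (Φ := (Φ : Set IForm))
  have eΓ : Γ.map (collapse (Φ : Set IForm)) = Γ :=
    (Multiset.map_congr rfl fun A hA => collapse_of_inFLei (hΓ A hA)).trans (Multiset.map_id' Γ)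
  have eX : X.map (collapse (Φ : Set IForm)) = X := by
    cases X with
    | none => rfl
    | some A => exact congrArg some (collapse_of_inFLei (hX A rfl))
  rw [Multiset.map_add, eΓ, eX] at hc
  refine hc.cut_all ?_
  intro D hD
  simp only [Multiset.mem_map, exists_exists_and_eq_and] at hD
  obtain ⟨B, hB, rfl⟩ := hD
  have hB' : IPrv (FLewc (Φ : Set IForm)) 0 (some (collapse (Φ : Set IForm) B)) := by
    rw [collapse_of_inFLei (hΦ B hB)]
    exact .axiom' hB
  rw [collapse, if_pos hB']
  exact .oneR trivial
end Affine
end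

section
/- Let Φ be a finite set of classical {⊗,⅋,&,⊕,1,⊥}-formulas and ⊢ Γ a classical {⊗,⅋,&,⊕,1,⊥}-sequent. Then ⊢ Γ is provable in InFLew[Φ] if and only if ⊢ ?Φ⊥,Γ is provable in LLW, where ?Φ⊥ is the multiset containing ?(B⊥) once for each B ∈ Φ. -/
namespace Affine

open scoped Pointwise

section Phase

variable {M : Type*} [AddCommMonoid M]

/-- The orthogonal of `S` with respect to the pole `P`. -/
def orth (P S : Set M) : Set M := {y | ∀ x ∈ S, x + y ∈ P}

theorem orth_anti (P : Set M) {S T : Set M} (h : S ⊆ T) : orth P T ⊆ orth P S :=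
  fun _ hy x hx => hy x (h hx)

theorem subset_orth_orth (P S : Set M) : S ⊆ orth P (orth P S) := by
  intro x hx y hy
  rw [add_comm]
  exact hy x hx

theorem orth_orth_orth (P S : Set M) : orth P (orth P (orth P S)) = orth P S :=
  Set.Subset.antisymm (orth_anti P (subset_orth_orth P S)) (subset_orth_orth P _)

theorem orth_union (P S T : Set M) : orth P (S ∪ T) = orth P S ∩ orth P T := by
  ext y
  simp only [orth, Set.mem_union, Set.mem_inter_iff, Set.mem_ofPred_eq]
  exact ⟨fun h => ⟨fun x hx => h x (.inl hx), fun x hx => h x (.inr hx)⟩,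
    fun h x hx => hx.elim (h.1 x) (h.2 x)⟩

/-- The elements that may be contracted with respect to the pole `P`. -/
def contractible (P : Set M) : AddSubmonoid M where
  carrier := {x | ∀ y, x + x + y ∈ P → x + y ∈ P}
  zero_mem' := by intro y h; simpa using h
  add_mem' := by
    intro a b ha hb y h
    have h₁ : a + (b + b + y) ∈ P := ha _ (by convert h using 1; abel)
    have h₂ : b + (a + y) ∈ P := hb _ (by convert h₁ using 1; abel)
    convert h₂ using 1
    abel

/-- Phase semantics of classical formulas with pole `P` and valuation `v` of the negative
literals. -/
def interp (P : Set M) (v : ℕ → Set M) : CForm → Set M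
  | .pos n => orth P (orth P (v n))
  | .neg n => orth P (v n)
  | .one => orth P P
  | .bot => orth P (orth P P)
  | .top => Set.univ
  | .zero => orth P Set.univ
  | .tensor A B => orth P (orth P (interp P v A + interp P v B))
  | .par A B => orth P (orth P (interp P v A) + orth P (interp P v B))
  | .and A B => interp P v A ∩ interp P v B
  | .or A B => orth P (orth P (interp P v A) ∩ orth P (interp P v B))
  | .bang A => orth P (orth P (interp P v A ∩ contractible P))
  | .quest A => orth P (orth P (interp P v A) ∩ contractible P)

variable {P : Set M} {v : ℕ → Set M}

theorem orth_orth_interp (A : CForm) :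
    orth P (orth P (interp P v A)) = interp P v A := by
  induction A with
  | top => exact Set.Subset.antisymm (Set.subset_univ _) (subset_orth_orth P _)
  | and A B ihA ihB =>
    refine Set.Subset.antisymm (Set.subset_inter ?_ ?_) (subset_orth_orth P _)
    · exact (orth_anti P (orth_anti P Set.inter_subset_left)).trans ihA.subset
    · exact (orth_anti P (orth_anti P Set.inter_subset_right)).trans ihB.subset
  | _ => exact orth_orth_orth P _

theorem interp_dual (A : CForm) : interp P v A.dual = orth P (interp P v A) := by
  induction A with
  | top => rfl
  | zero =>
    exact (orth_orth_interp (P := P) (v := v) .top).symm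
  | or A B ihA ihB =>
    simp only [interp, CForm.dual, ihA, ihB, ← orth_union, orth_orth_orth]
  | _ => simp_all [interp, CForm.dual, orth_orth_orth, orth_orth_interp]

/-- The pointwise sums of counter-elements of the formulas of `Γ`. -/
def counter (P : Set M) (v : ℕ → Set M) (Γ : Multiset CForm) : Set M :=
  (Γ.map fun A => orth P (interp P v A)).sum

theorem counter_add (Γ Δ : Multiset CForm) :
    counter P v (Γ + Δ) = counter P v Γ + counter P v Δ := by
  simp [counter]

theorem counter_cons_subset (A : CForm) (Γ : Multiset CForm) :
    counter P v (A ::ₘ Γ) ⊆ P ↔ counter P v Γ ⊆ interp P v A := by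
  rw [counter, Multiset.map_cons, Multiset.sum_cons]
  constructor
  · intro h g hg
    rw [← orth_orth_interp]
    exact fun x hx => h (Set.add_mem_add hx hg)
  · rintro h _ ⟨x, hx, g, hg, rfl⟩
    change x + g ∈ P
    rw [add_comm]
    exact hx g (h hg)

theorem counter_map_quest_add_mem (Γ : Multiset CForm) (Y : Set M)
    (h : ∀ g ∈ (Γ.map fun A => orth P (interp P v A) ∩ (contractible P : Set M)).sum,
      ∀ y ∈ Y, g + y ∈ P) :
    ∀ g ∈ counter P v (Γ.map .quest), ∀ y ∈ Y, g + y ∈ P := by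
  induction Γ using Multiset.induction generalizing Y with
  | empty => simpa [counter] using h
  | cons A Γ ih =>
    simp only [counter, Multiset.map_cons, Multiset.sum_cons] at h ⊢
    rintro _ ⟨x, hx, g, hg, rfl⟩ y hy
    have key : g + y ∈ orth P (orth P (interp P v A) ∩ contractible P) := by
      intro c hc
      have := ih ({c} + Y) ?_ g hg (c + y) (Set.add_mem_add rfl hy)
      · convert this using 1
        abel
      · rintro g hg _ ⟨_, rfl, z, hz, rfl⟩
        have := h (_ + g) (Set.add_mem_add hc hg) z hz
        convert this using 1
        simp only
        abel
    have := hx _ key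
    convert this using 1
    simp only
    abel

theorem sum_inter_contractible_subset (Γ : Multiset CForm) :
    (Γ.map fun A => orth P (interp P v A) ∩ (contractible P : Set M)).sum ⊆
      contractible P := by
  induction Γ using Multiset.induction with
  | empty => simp
  | cons A Γ ih =>
    simp only [Multiset.map_cons, Multiset.sum_cons]
    rintro _ ⟨x, hx, g, hg, rfl⟩
    exact add_mem hx.2 (ih hg)

theorem sum_inter_contractible_subset_counter (Γ : Multiset CForm) :
    (Γ.map fun A => orth P (interp P v A) ∩ (contractible P : Set M)).sum ⊆
      counter P v (Γ.map .quest) := by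
  induction Γ using Multiset.induction with
  | empty => simp [counter]
  | cons A Γ ih =>
    simp only [counter, Multiset.map_cons, Multiset.sum_cons] at ih ⊢
    exact Set.add_subset_add (subset_orth_orth P _) ih

/-- Soundness of phase semantics for affine logic. -/
theorem counter_subset_of_prv (hP : ∀ x ∈ P, ∀ y, y + x ∈ P) {Γ : Multiset CForm}
    (h : CPrv (LLWc ∅) Γ) : counter P v Γ ⊆ P := by
  induction h with
  | axiom' h => exact h.elim
  | @init A =>
    rw [Multiset.insert_eq_cons, counter_cons_subset]
    simp [counter, interp_dual, orth_orth_interp]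
  | one =>
    rw [← Multiset.cons_zero, counter_cons_subset]
    exact fun g _ x hx => add_comm g x ▸ hP x hx g
  | top => exact (counter_cons_subset _ _).2 (Set.subset_univ _)
  | @cut Γ Δ A _ _ ih₁ ih₂ =>
    rw [counter_cons_subset] at ih₁ ih₂
    rw [interp_dual] at ih₂
    rw [counter_add]
    rintro _ ⟨g, hg, d, hd, rfl⟩
    exact ih₂ hd _ (ih₁ hg)
  | bot _ _ ih =>
    rw [counter_cons_subset]
    exact ih.trans (subset_orth_orth P P)
  | tensor _ _ _ ih₁ ih₂ =>
    rw [counter_cons_subset] at *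
    rw [counter_add]
    exact (Set.add_subset_add ih₁ ih₂).trans (subset_orth_orth P _)
  | par _ _ ih =>
    rw [counter_cons_subset]
    rintro g hg _ ⟨a, ha, b, hb, rfl⟩
    apply ih
    simp only [counter, Multiset.map_cons, Multiset.sum_cons]
    rw [← add_assoc]
    exact Set.add_mem_add (Set.add_mem_add ha hb) hg
  | with' _ _ _ ih₁ ih₂ =>
    rw [counter_cons_subset] at *
    exact Set.subset_inter ih₁ ih₂
  | plus1 _ _ ih =>
    rw [counter_cons_subset] at *
    refine ih.trans ((subset_orth_orth P _).trans (orth_anti P Set.inter_subset_left))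
  | plus2 _ _ ih =>
    rw [counter_cons_subset] at *
    refine ih.trans ((subset_orth_orth P _).trans (orth_anti P Set.inter_subset_right))
  | der _ _ _ ih =>
    rw [counter_cons_subset] at *
    refine ih.trans ((subset_orth_orth P _).trans (orth_anti P Set.inter_subset_left))
  | @prom Γ A _ _ _ _ ih =>
    rw [counter_cons_subset] at *
    intro g hg y hy
    rw [add_comm]
    refine counter_map_quest_add_mem Γ {y} ?_ g hg y rfl
    rintro c hc _ rfl
    exact hy c ⟨ih (sum_inter_contractible_subset_counter Γ hc),
      sum_inter_contractible_subset Γ hc⟩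
  | @wk Γ A _ _ _ ih =>
    simp only [counter, Multiset.map_cons, Multiset.sum_cons]
    rintro _ ⟨x, -, g, hg, rfl⟩
    exact hP g (ih hg) x
  | questW h => exact h.elim
  | questC _ _ ih =>
    rw [counter_cons_subset]
    intro g hg c hc
    apply hc.2 g
    apply ih
    simp only [counter, Multiset.map_cons, Multiset.sum_cons]
    rw [← add_assoc]
    have hc' := subset_orth_orth P _ hc
    exact Set.add_mem_add (Set.add_mem_add hc' hc') hg
  | funcF h => exact h.elim

end Phase

theorem CForm.inMALL.dual {A : CForm} (h : A.inMALL) : A.dual.inMALL := by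
  induction A <;> simp_all [CForm.inMALL, CForm.dual]

theorem CForm.dual_dual (A : CForm) : A.dual.dual = A := by
  induction A <;> simp_all [CForm.dual]

theorem CPrv.weaken {C : CCalc} (hC : C.wk) {Γ : Multiset CForm} (h : CPrv C Γ)
    (Δ : Multiset CForm) (hΔ : ∀ A ∈ Δ, C.K A) : CPrv C (Δ + Γ) := by
  induction Δ using Multiset.induction with
  | empty => simpa using h
  | cons A Δ ih =>
    rw [Multiset.cons_add]
    exact .wk hC (hΔ A (by simp)) (ih fun B hB => hΔ B (by simp [hB]))

theorem CPrv.contract {C : CCalc} (Δ Γ : Multiset CForm) (hΔ : ∀ B ∈ Δ, C.K (.quest B))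
    (h : CPrv C (Δ.map .quest + Δ.map .quest + Γ)) : CPrv C (Δ.map .quest + Γ) := by
  induction Δ using Multiset.induction generalizing Γ with
  | empty => simpa using h
  | cons A Δ ih =>
    simp only [Multiset.map_cons, Multiset.cons_add, Multiset.add_cons] at h ⊢
    refine .questC (hΔ A (by simp)) ?_
    rw [← Multiset.add_cons, ← Multiset.add_cons]
    refine ih _ (fun B hB => hΔ B (by simp [hB])) ?_
    simpa only [Multiset.add_cons] using h

/-- The multisets provable in `InFLew[Φ]`, extended by those outside its language. -/
def provable (Φ : Set CForm) : Set (Multiset CForm) :=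
  {Γ | (∀ A ∈ Γ, A.inMALL) → CPrv (InFLewc Φ) Γ}

theorem add_mem_provable {Φ : Set CForm} (Γ : Multiset CForm) (h : Γ ∈ provable Φ)
    (Δ : Multiset CForm) : Δ + Γ ∈ provable Φ := by
  intro hK
  simp only [Multiset.mem_add] at hK
  exact (h fun A hA => hK A (.inr hA)).weaken trivial Δ fun A hA => hK A (.inl hA)

/-- The phase interpretation in the syntactic model of `InFLew[Φ]`. -/
abbrev synInterp (Φ : Set CForm) : CForm → Set (Multiset CForm) :=
  interp (provable Φ) fun n => {{.neg n}}

theorem singleton_mem_orth_synInterp (Φ : Set CForm) {A : CForm} (hA : A.inMALL) :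
    {A} ∈ orth (provable Φ) (synInterp Φ A) := by
  induction A with
  | pos n =>
    rw [synInterp, interp, orth_orth_orth]
    rintro _ rfl _
    rw [Multiset.singleton_add]
    exact .init (A := .neg n) trivial trivial
  | neg n => exact subset_orth_orth _ _ rfl
  | one =>
    intro x _
    exact add_mem_provable _ (fun _ => .one trivial) x
  | bot =>
    rw [synInterp, interp, orth_orth_orth]
    intro x hx hK
    rw [add_comm, Multiset.singleton_add] at hK ⊢
    simp only [Multiset.mem_cons, forall_eq_or_imp] at hK
    exact .bot trivial (hx hK.2)
  | tensor A B ihA ihB =>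
    rw [synInterp, interp, orth_orth_orth]
    rintro _ ⟨x, hx, y, hy, rfl⟩ hK
    have h₁ := ihA hA.1 x hx
    have h₂ := ihB hA.2 y hy
    simp only [add_comm _ ({_} : Multiset CForm), Multiset.singleton_add, provable,
      Set.mem_ofPred_eq, Multiset.mem_cons, forall_eq_or_imp, Multiset.mem_add] at hK h₁ h₂ ⊢
    exact .tensor hA (h₁ ⟨hA.1, fun C hC => hK.2 C (.inl hC)⟩)
      (h₂ ⟨hA.2, fun C hC => hK.2 C (.inr hC)⟩)
  | par A B ihA ihB =>
    intro x hx hK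
    have h := hx _ (Set.add_mem_add (ihA hA.1) (ihB hA.2))
    rw [add_comm, Multiset.singleton_add] at hK ⊢
    simp only [Multiset.singleton_add, Multiset.cons_add, provable,
      Set.mem_ofPred_eq, Multiset.mem_cons, forall_eq_or_imp] at hK h
    exact .par hA (h ⟨hA.1, hA.2, hK.2⟩)
  | and A B ihA ihB =>
    intro x hx hK
    have h₁ := ihA hA.1 x hx.1
    have h₂ := ihB hA.2 x hx.2
    simp only [add_comm _ ({_} : Multiset CForm), Multiset.singleton_add, provable,
      Set.mem_ofPred_eq, Multiset.mem_cons, forall_eq_or_imp] at hK h₁ h₂ ⊢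
    exact .with' hA (h₁ ⟨hA.1, hK.2⟩) (h₂ ⟨hA.2, hK.2⟩)
  | or A B ihA ihB =>
    refine subset_orth_orth _ _ ⟨fun x hx hK => ?_, fun x hx hK => ?_⟩
    · have h := ihA hA.1 x hx
      simp only [add_comm _ ({_} : Multiset CForm), Multiset.singleton_add, provable,
        Set.mem_ofPred_eq, Multiset.mem_cons, forall_eq_or_imp] at hK h ⊢
      exact .plus1 hA (h ⟨hA.1, hK.2⟩)
    · have h := ihB hA.2 x hx
      simp only [add_comm _ ({_} : Multiset CForm), Multiset.singleton_add, provable,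
        Set.mem_ofPred_eq, Multiset.mem_cons, forall_eq_or_imp] at hK h ⊢
      exact .plus2 hA (h ⟨hA.2, hK.2⟩)
  | top => exact hA.elim
  | zero => exact hA.elim
  | bang => exact hA.elim
  | quest => exact hA.elim

theorem zero_mem_synInterp {Φ : Set CForm} {B : CForm} (hB : B.inMALL) (hΦ : B ∈ Φ) :
    0 ∈ synInterp Φ B := by
  have hd := singleton_mem_orth_synInterp Φ hB.dual
  rw [synInterp, interp_dual, orth_orth_interp] at hd
  rw [synInterp, ← orth_orth_interp]
  intro x hx hK
  have h := hx _ hd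
  rw [add_zero] at hK ⊢
  rw [← zero_add x]
  refine .cut (A := B) (.axiom' hΦ) (h ?_)
  simpa [hB.dual] using hK

theorem self_mem_counter (Φ : Set CForm) (Γ : Multiset CForm) (hΓ : ∀ A ∈ Γ, A.inMALL) :
    Γ ∈ counter (provable Φ) (fun n => {{.neg n}}) Γ := by
  induction Γ using Multiset.induction with
  | empty => simp [counter]
  | cons A Γ ih =>
    simp only [counter, Multiset.map_cons, Multiset.sum_cons]
    rw [← Multiset.singleton_add]
    exact Set.add_mem_add (singleton_mem_orth_synInterp Φ (hΓ A (by simp)))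
      (ih fun B hB => hΓ B (by simp [hB]))

theorem zero_mem_counter_quest_dual (Φ : Set CForm) (Δ : Multiset CForm)
    (h : ∀ B ∈ Δ, B.inMALL ∧ B ∈ Φ) :
    0 ∈ counter (provable Φ) (fun n => {{.neg n}}) (Δ.map fun B => .quest B.dual) := by
  induction Δ using Multiset.induction with
  | empty => simp [counter]
  | cons B Δ ih =>
    simp only [counter, Multiset.map_cons, Multiset.sum_cons] at ih ⊢
    rw [← add_zero (0 : Multiset CForm)]
    refine Set.add_mem_add (subset_orth_orth _ _ ⟨?_, zero_mem _⟩)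
      (ih fun C hC => h C (by simp [hC]))
    rw [interp_dual, orth_orth_interp]
    exact zero_mem_synInterp (h B (by simp)).1 (h B (by simp)).2

theorem prv_of_inflew {Φ : Set CForm} {Ψ Γ : Multiset CForm} (hΦ : ∀ B ∈ Φ, B.dual ∈ Ψ)
    (h : CPrv (InFLewc Φ) Γ) : CPrv (LLWc ∅) (Ψ.map .quest + Γ) := by
  have weaken {Γ} (h : CPrv (LLWc ∅) Γ) : CPrv (LLWc ∅) (Ψ.map .quest + Γ) :=
    h.weaken trivial _ fun _ _ => trivial
  have contract {Γ Δ} (h : CPrv (LLWc ∅) ((Ψ.map .quest + Γ) + (Ψ.map .quest + Δ))) :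
      CPrv (LLWc ∅) (Ψ.map .quest + (Γ + Δ)) :=
    .contract _ _ (fun _ _ => trivial) (by convert h using 1; abel)
  induction h with
  | @axiom' B hB =>
    obtain ⟨Ψ', rfl⟩ := Multiset.exists_cons_of_mem (hΦ B hB)
    have h : CPrv (LLWc ∅) (.quest B.dual ::ₘ {B}) := by
      refine .der trivial trivial ?_
      have := CPrv.init (C := LLWc ∅) (A := B.dual) trivial trivial
      rwa [CForm.dual_dual] at this
    have := h.weaken trivial (Ψ'.map .quest) fun _ _ => trivial
    simpa only [Multiset.map_cons, Multiset.cons_add, Multiset.add_cons] using this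
  | init => exact weaken (.init trivial trivial)
  | one => exact weaken (.one trivial)
  | top h => exact h.elim
  | cut _ _ ih₁ ih₂ =>
    rw [Multiset.add_cons] at ih₁ ih₂
    exact contract (.cut ih₁ ih₂)
  | bot _ _ ih =>
    rw [Multiset.add_cons]
    exact .bot trivial ih
  | tensor _ _ _ ih₁ ih₂ =>
    rw [Multiset.add_cons] at ih₁ ih₂
    rw [← Multiset.cons_add]
    apply contract
    rw [Multiset.add_cons, Multiset.cons_add]
    exact .tensor trivial ih₁ ih₂
  | par _ _ ih =>
    simp only [Multiset.add_cons] at ih ⊢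
    exact .par trivial ih
  | with' _ _ _ ih₁ ih₂ =>
    rw [Multiset.add_cons] at *
    exact .with' trivial ih₁ ih₂
  | plus1 _ _ ih =>
    rw [Multiset.add_cons] at *
    exact .plus1 trivial ih
  | plus2 _ _ ih =>
    rw [Multiset.add_cons] at *
    exact .plus2 trivial ih
  | der h => exact h.elim
  | prom h => exact h.elim
  | wk _ _ _ ih =>
    rw [Multiset.add_cons]
    exact .wk trivial trivial ih
  | questW h => exact h.elim
  | questC h => exact h.elim
  | funcF h => exact h.elim

/-- `⊢ Γ` is provable in InFLew[Φ] iff `⊢ ?Φ⊥,Γ` is provable in LLW. -/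
theorem inflew_deducibility_iff_llw (Φ : Finset CForm) (Γ : Multiset CForm)
    (hΦ : ∀ B ∈ Φ, B.inMALL) (hΓ : ∀ A ∈ Γ, A.inMALL) :
    CPrv (InFLewc ↑Φ) Γ ↔
      CPrv (LLWc ∅) (Φ.val.map (fun B => CForm.quest B.dual) + Γ) := by
  constructor
  · intro h
    have := prv_of_inflew (Ψ := Φ.val.map CForm.dual)
      (fun B hB => Multiset.mem_map_of_mem _ hB) h
    rwa [Multiset.map_map] at this
  · intro h
    have hc := counter_subset_of_prv (v := fun n => {{.neg n}})
      (add_mem_provable (Φ := (Φ : Set CForm))) h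
    rw [counter_add] at hc
    have hmem := hc (Set.add_mem_add
      (zero_mem_counter_quest_dual _ Φ.val fun B hB => ⟨hΦ B hB, hB⟩) (self_mem_counter _ Γ hΓ))
    rw [zero_add] at hmem
    exact hmem hΓ
end Affine
end
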